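/- (Minorization plus invariance gives uniform ergodicity with explicit geometric rate.) Let P be a Markov kernel on a measurable space X with invariant probability measure π. Suppose there exist an integer m ≥ 1, a constant s ∈ (0,1], and a probability measure ν on X such that P^m(x, A) ≥ s·ν(A) for all x ∈ X and all measurable A. Then for every x ∈ X and every n ≥ 0, ‖P^n(x,·) − π‖_TV ≤ 2(1 − s)^{⌊n/m⌋}; in particular P is uniformly ergodic: sup_{x∈X} ‖P^n(x,·) − π‖_TV → 0 as n → ∞. -/

import Mathlib

open MeasureTheory ProbabilityTheory Filter

/-- Total variation distance between two measures:
`‖μ − ν‖_TV = 2 · sup_{A measurable} |μ(A) − ν(A)|`. -/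
noncomputable def tvDist {X : Type*} [MeasurableSpace X] (μ ν : Measure X) : ℝ :=
  2 * ⨆ (A : Set X) (_ : MeasurableSet A), |(μ A).toReal - (ν A).toReal|

/-- `kIter P n` is the `n`-step iterate `P^n` of the Markov kernel `P`. -/
noncomputable def kIter {X : Type*} [MeasurableSpace X] (P : Kernel X X) : ℕ → Kernel X X
  | 0 => Kernel.id
  | n + 1 => (kIter P n) ∘ₖ P

theorem kIter_add' {X : Type*} [MeasurableSpace X] (P : Kernel X X) (n m : ℕ) :
    kIter P (n + m) = kIter P n ∘ₖ kIter P m := by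
  induction m with
  | zero => simp [kIter]
  | succ m ih =>
    rw [← add_assoc, kIter, kIter, ih, Kernel.comp_assoc]

theorem kIter_markov {X : Type*} [MeasurableSpace X] (P : Kernel X X) [IsMarkovKernel P] (n : ℕ) :
    IsMarkovKernel (kIter P n) := by
  induction n with
  | zero => rw [kIter]; infer_instance
  | succ n ih => rw [kIter]; infer_instance

theorem kIter_inv {X : Type*} [MeasurableSpace X] (P : Kernel X X)
    (π : Measure X) (hinv : π.bind (fun x => P x) = π) (n : ℕ) :
    π.bind (kIter P n) = π := by
  induction n with
  | zero => rw [kIter]; exact Measure.id_comp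
  | succ n ih =>
    rw [kIter, ← Measure.comp_assoc]
    change (π.bind (fun x => P x)).bind (kIter P n) = π
    rw [hinv, ih]

theorem bind_real {X : Type*} [MeasurableSpace X] (K : Kernel X X) [IsMarkovKernel K]
    (μ : Measure X) (A : Set X) (hA : MeasurableSet A) :
    ((μ.bind K) A).toReal = ∫ y, (K y A).toReal ∂μ := by
  rw [Measure.bind_apply hA K.measurable.aemeasurable, integral_toReal]
  · exact (K.measurable_coe hA).aemeasurable
  · exact ae_of_all _ fun y => measure_lt_top _ _

theorem osc {X : Type*} [MeasurableSpace X]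
    (P : Kernel X X) [IsMarkovKernel P]
    (m : ℕ) (s : ℝ) (hs : s ∈ Set.Ioc (0 : ℝ) 1)
    (ν : Measure X) [IsProbabilityMeasure ν]
    (hmin : ∀ (x : X) (A : Set X), MeasurableSet A →
      ENNReal.ofReal s * ν A ≤ (kIter P m) x A) (A : Set X) (hA : MeasurableSet A) (r k : ℕ) :
    ∃ a : ℝ, ∀ x, a ≤ (kIter P (r + m * k) x A).toReal ∧
      (kIter P (r + m * k) x A).toReal ≤ a + (1 - s) ^ k := by
  have := kIter_markov P
  induction k with
  | zero =>
    refine ⟨0, fun x => ⟨ENNReal.toReal_nonneg, ?_⟩⟩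
    simpa using ENNReal.toReal_mono ENNReal.one_ne_top
      (prob_le_one (μ := kIter P (r + m * 0) x) (s := A))
  | succ k ih =>
    obtain ⟨a, ha⟩ := ih
    set f : X → ℝ := fun x => (kIter P (r + m * k) x A).toReal with hf
    have hfm : Measurable f := ((kIter P (r + m * k)).measurable_coe hA).ennreal_toReal
    have hint : ∀ (μ : Measure X) [IsFiniteMeasure μ], Integrable f μ := by
      intro μ _
      refine Integrable.of_mem_Icc a (a + (1 - s) ^ k) hfm.aemeasurable (ae_of_all _ fun x => ha x)
    refine ⟨a + s * (∫ y, f y ∂ν - a), fun x => ?_⟩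
    have heq : (kIter P (r + m * (k + 1)) x A).toReal = ∫ y, f y ∂(kIter P m x) := by
      rw [Nat.mul_succ, ← add_assoc, kIter_add', Kernel.comp_apply, bind_real _ _ _ hA]
    have hle : ENNReal.ofReal s • ν ≤ kIter P m x := by
      refine Measure.le_iff.2 fun B hB => ?_
      simpa using hmin x B hB
    have h1 := integral_mono_measure (f := fun y => f y - a) hle
      (ae_of_all _ fun y => sub_nonneg.2 (ha y).1) ((hint _).sub (integrable_const a))
    have h2 := integral_mono_measure (f := fun y => (a + (1 - s) ^ k) - f y) hle
      (ae_of_all _ fun y => sub_nonneg.2 (ha y).2) ((integrable_const _).sub (hint _))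
    rw [integral_smul_measure, integral_sub (hint _) (integrable_const _),
      integral_sub (hint _) (integrable_const _)] at h1
    rw [integral_smul_measure, integral_sub (integrable_const _) (hint _),
      integral_sub (integrable_const _) (hint _)] at h2
    simp only [ENNReal.toReal_ofReal hs.1.le, integral_const, probReal_univ, smul_eq_mul,
      one_mul] at h1 h2
    rw [heq, pow_succ]
    constructor <;> linarith

/-- **Minorization plus invariance gives uniform ergodicity with explicit geometric
rate.**  Let `P` be a Markov kernel on `X` with invariant probability measure `π`.
Suppose there exist an integer `m ≥ 1`, a constant `s ∈ (0,1]`, and a probability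
measure `ν` on `X` such that `P^m(x,A) ≥ s·ν(A)` for all `x` and measurable `A`.  Then
for every `x ∈ X` and every `n ≥ 0`, `‖P^n(x,·) − π‖_TV ≤ 2(1 − s)^{⌊n/m⌋}`; in
particular `P` is uniformly ergodic: `sup_x ‖P^n(x,·) − π‖_TV → 0` as `n → ∞`. -/
theorem minorization_uniform_ergodicity
    {X : Type*} [MeasurableSpace X]
    (P : Kernel X X) [IsMarkovKernel P]
    (π : Measure X) [IsProbabilityMeasure π]
    (hinv : π.bind (fun x => P x) = π)
    (m : ℕ) (hm : 1 ≤ m)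
    (s : ℝ) (hs : s ∈ Set.Ioc (0 : ℝ) 1)
    (ν : Measure X) [IsProbabilityMeasure ν]
    (hmin : ∀ (x : X) (A : Set X), MeasurableSet A →
      ENNReal.ofReal s * ν A ≤ (kIter P m) x A) :
    (∀ (x : X) (n : ℕ), tvDist ((kIter P n) x) π ≤ 2 * (1 - s) ^ (n / m)) ∧
    Tendsto (fun n : ℕ => ⨆ x : X, tvDist ((kIter P n) x) π) atTop (nhds 0) := by
  have := kIter_markov P
  obtain ⟨hs0, hs1⟩ := hs
  have hb : ∀ (x : X) (n : ℕ), tvDist ((kIter P n) x) π ≤ 2 * (1 - s) ^ (n / m) := by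
    intro x n
    have hp : (0 : ℝ) ≤ (1 - s) ^ (n / m) := pow_nonneg (by linarith) _
    refine mul_le_mul_of_nonneg_left ?_ zero_le_two
    refine Real.iSup_le (fun A => Real.iSup_le (fun hA => ?_) hp) hp
    obtain ⟨a, ha⟩ := osc P m s ⟨hs0, hs1⟩ ν hmin A hA (n % m) (n / m)
    rw [Nat.mod_add_div] at ha
    have hπ : (π A).toReal = ∫ y, (kIter P n y A).toReal ∂π := by
      rw [← bind_real _ _ _ hA, kIter_inv P π hinv]
    have hi : Integrable (fun y => (kIter P n y A).toReal) π :=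
      Integrable.of_mem_Icc a (a + (1 - s) ^ (n / m))
        ((kIter P n).measurable_coe hA).ennreal_toReal.aemeasurable (ae_of_all _ fun x => ha x)
    have h1 := integral_mono (integrable_const (μ := π) a) hi (fun y => (ha y).1)
    have h2 := integral_mono hi (integrable_const (μ := π) (a + (1 - s) ^ (n / m)))
      (fun y => (ha y).2)
    simp only [integral_const, probReal_univ, smul_eq_mul, one_mul] at h1 h2
    rw [hπ, abs_le]
    have := ha x
    constructor <;> linarith [this.1, this.2]
  refine ⟨hb, ?_⟩
  have hlim : Tendsto (fun n : ℕ => 2 * (1 - s) ^ (n / m)) atTop (nhds 0) := by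
    have h := ((tendsto_pow_atTop_nhds_zero_of_lt_one (r := 1 - s) (by linarith)
      (by linarith)).comp (Nat.tendsto_div_const_atTop (by omega : m ≠ 0))).const_mul 2
    simpa using h
  refine squeeze_zero (fun n => ?_) (fun n => ?_) hlim
  · refine Real.iSup_nonneg fun x => mul_nonneg zero_le_two ?_
    exact Real.iSup_nonneg fun A => Real.iSup_nonneg fun hA => abs_nonneg _
  · exact Real.iSup_le (fun x => hb x n)
      (mul_nonneg zero_le_two (pow_nonneg (by linarith) _))
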